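/- Let 0 < α < 1, 1 < β < 2, and a, b > 0, and let (λ_k) be a sequence of positive reals with λ_k → ∞. Define Δ(k) = E_{α,1}(-λ_k b^α) - (E_{β,1}(-λ_k a^β) + a λ_k E_{β,2}(-λ_k a^β)). Then Δ(k) → -1/(a^{β-1} Γ(2-β)) as k → ∞. -/

import Mathlib

open Real Filter

noncomputable def mittagLeffler (μ η z : ℝ) : ℝ := ∑' n : ℕ, z ^ n / Real.Gamma (μ * n + η)

open MeasureTheory Topology
open scoped FourierTransform

lemma norm_add_mul_I_rpow_neg_le {c p : ℝ} (hc : 1 ≤ c) (hp : 0 ≤ p) (y : ℝ) :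
    ‖(c : ℂ) + y * Complex.I‖ ^ (-p) ≤ ((1 : ℝ) + ‖y‖ ^ 2) ^ (-p / 2) := by
  rw [Complex.norm_add_mul_I, Real.sqrt_eq_rpow, ← Real.rpow_mul (by positivity),
    show 1 / 2 * -p = -p / 2 by ring]
  apply Real.rpow_le_rpow_of_nonpos (by positivity) _ (by linarith)
  rw [Real.norm_eq_abs, sq_abs]
  nlinarith

lemma add_mul_I_mem_slitPlane {c : ℝ} (hc : 0 < c) (y : ℝ) :
    (c : ℂ) + y * Complex.I ∈ Complex.slitPlane := by
  left
  simpa using hc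

lemma add_mul_I_ne_zero {c : ℝ} (hc : 0 < c) (y : ℝ) : (c : ℂ) + y * Complex.I ≠ 0 :=
  Complex.slitPlane_ne_zero (add_mul_I_mem_slitPlane hc y)

lemma integrable_norm_add_mul_I_rpow_neg {c p : ℝ} (hc : 1 ≤ c) (hp : 1 < p) :
    Integrable (fun y : ℝ => ‖(c : ℂ) + y * Complex.I‖ ^ (-p)) := by
  refine (integrable_rpow_neg_one_add_norm_sq (E := ℝ) (r := p) (by simpa using hp)).mono' ?_ ?_
  · refine (Continuous.rpow_const (by fun_prop) fun y => Or.inl ?_).aestronglyMeasurable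
    exact norm_ne_zero_iff.mpr (add_mul_I_ne_zero (by linarith) y)
  · refine ae_of_all _ fun y => ?_
    rw [Real.norm_of_nonneg (by positivity)]
    exact norm_add_mul_I_rpow_neg_le hc (by linarith) y

/-- The Laplace transform of a power function on the right half plane. -/
lemma integral_cpow_mul_cexp_neg_mul_Ioi {a : ℝ} (ha : 0 < a) {r : ℂ} (hr : 0 < r.re) :
    ∫ u : ℝ in Set.Ioi 0, (u : ℂ) ^ ((a : ℂ) - 1) * Complex.exp (-(r * u)) =
      (1 / r) ^ (a : ℂ) * Complex.Gamma a := by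
  set U : Set ℂ := {w | 0 < w.re}
  have hU : IsOpen U := isOpen_lt continuous_const Complex.continuous_re
  have hnorm : ∀ (w : ℂ) (u : ℝ), 0 < u →
      ‖(u : ℂ) ^ ((a : ℂ) - 1) * Complex.exp (-(w * u))‖ = u ^ (a - 1) * rexp (-(w.re * u)) := by
    intro w u hu
    rw [norm_mul, Complex.norm_exp, Complex.norm_cpow_eq_rpow_re_of_pos hu]
    simp
  have hcont : ∀ w : ℂ, ContinuousOn
      (fun u : ℝ => (u : ℂ) ^ ((a : ℂ) - 1) * Complex.exp (-(w * u))) (Set.Ioi 0) := by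
    intro w u hu
    refine ContinuousAt.continuousWithinAt (ContinuousAt.mul ?_ (by fun_prop))
    exact ContinuousAt.cpow (by fun_prop) (by fun_prop) (Or.inl (by simpa using hu))
  have hd : DifferentiableOn ℂ (fun w : ℂ =>
      ∫ u : ℝ in Set.Ioi 0, (u : ℂ) ^ ((a : ℂ) - 1) * Complex.exp (-(w * u))) U := by
    intro w hw
    have hw : 0 < w.re := hw
    have hs : {v : ℂ | w.re / 2 < v.re} ∈ 𝓝 w :=
      (isOpen_lt continuous_const Complex.continuous_re).mem_nhds (by simp; linarith)
    refine (hasDerivAt_integral_of_dominated_loc_of_deriv_le (𝕜 := ℂ)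
      (μ := volume.restrict (Set.Ioi (0 : ℝ)))
      (F := fun w u => (u : ℂ) ^ ((a : ℂ) - 1) * Complex.exp (-(w * u)))
      (F' := fun w u => (u : ℂ) ^ ((a : ℂ) - 1) * (Complex.exp (-(w * u)) * -u))
      (bound := fun u => u ^ a * rexp (-(w.re / 2) * u ^ (1 : ℝ)))
      hs ?_ ?_ ?_ ?_ ?_ ?_).2.differentiableAt.differentiableWithinAt
    · exact Eventually.of_forall fun v =>
        (hcont v).aestronglyMeasurable measurableSet_Ioi
    · have h := integrableOn_rpow_mul_exp_neg_mul_rpow (p := 1) (s := a - 1) (b := w.re)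
        (by linarith) one_pos hw
      refine Integrable.mono' h ((hcont w).aestronglyMeasurable measurableSet_Ioi) ?_
      filter_upwards [ae_restrict_mem measurableSet_Ioi] with u hu
      rw [hnorm w u hu]
      simp
    · refine ContinuousOn.aestronglyMeasurable ?_ measurableSet_Ioi
      simp_rw [← mul_assoc]
      exact (hcont w).mul (by fun_prop)
    · filter_upwards [ae_restrict_mem measurableSet_Ioi] with u hu v hv
      have hu : 0 < u := hu
      have hv : w.re / 2 < v.re := hv
      rw [← mul_assoc, norm_mul, hnorm v u hu, norm_neg, Complex.norm_real,
        Real.norm_of_nonneg hu.le, mul_right_comm, ← Real.rpow_add_one hu.ne', sub_add_cancel,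
        Real.rpow_one]
      gcongr
      nlinarith
    · exact integrableOn_rpow_mul_exp_neg_mul_rpow (by linarith) one_pos (by linarith)
    · refine Eventually.of_forall fun u v _ => HasDerivAt.const_mul _ (HasDerivAt.cexp ?_)
      exact (hasDerivAt_mul_const (u : ℂ)).fun_neg
  have hg : DifferentiableOn ℂ (fun w : ℂ => (1 / w) ^ (a : ℂ) * Complex.Gamma a) U := by
    intro w hw
    have hw : 0 < w.re := hw
    have hw0 : w ≠ 0 := by rintro rfl; simp at hw
    refine DifferentiableAt.differentiableWithinAt (DifferentiableAt.mul_const ?_ _)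
    refine DifferentiableAt.cpow_const ?_ ?_
    · exact (differentiableAt_const _).div differentiableAt_id hw0
    · left
      rw [one_div, Complex.inv_re]
      exact div_pos hw (Complex.normSq_pos.mpr hw0)
  have hUc : IsPreconnected U := (convex_halfSpace_re_gt 0).isPreconnected
  refine (hd.analyticOnNhd hU).eqOn_of_preconnected_of_frequently_eq (hg.analyticOnNhd hU) hUc
    (show (1 : ℂ) ∈ U by simp [U]) ?_ hr
  have ht : Tendsto (fun x : ℝ => (x : ℂ)) (𝓝[≠] 1) (𝓝[≠] 1) := by
    refine tendsto_nhdsWithin_of_tendsto_nhds_of_eventually_within _ ?_ ?_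
    · exact (Complex.continuous_ofReal.tendsto' 1 1 (by simp)).mono_left nhdsWithin_le_nhds
    · filter_upwards [self_mem_nhdsWithin] with x hx
      simpa using hx
  refine ht.frequently (Eventually.frequently ?_)
  filter_upwards [nhdsWithin_le_nhds (Ioi_mem_nhds (zero_lt_one' ℝ))] with x hx
  exact Complex.integral_cpow_mul_exp_neg_mul_Ioi (by simpa using ha) hx

/-- Laplace's integral for the reciprocal Gamma function. -/
lemma integral_exp_mul_cpow_neg {c z : ℝ} (hc : 1 ≤ c) (hz : 0 < z) :
    ∫ y : ℝ, Complex.exp ((c : ℂ) + y * Complex.I) *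
      ((c : ℂ) + y * Complex.I) ^ ((-(z + 1) : ℝ) : ℂ) = ((2 * π / Real.Gamma (z + 1) : ℝ) : ℂ) := by
  have hc0 : 0 < c := by linarith
  set f : ℝ → ℂ := (Set.Ioi (0 : ℝ)).indicator
    (fun u => (u : ℂ) ^ ((z + 1 : ℂ) - 1) * Complex.exp (-(c * u))) with hf
  have hfi : Integrable f := by
    rw [hf, integrable_indicator_iff measurableSet_Ioi]
    have h := integrableOn_rpow_mul_exp_neg_mul_rpow (p := 1) (s := z) (b := c)
      (by linarith) one_pos hc0
    refine IntegrableOn.congr_fun (Integrable.ofReal (𝕜 := ℂ) h) (fun u hu => ?_) measurableSet_Ioi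
    have hu : 0 < u := hu
    simp [Complex.ofReal_cpow hu.le]
  have hF : ∀ ξ : ℝ, 𝓕 f ξ = Complex.Gamma (z + 1) *
      ((c : ℂ) + (2 * π * ξ : ℝ) * Complex.I) ^ ((-(z + 1) : ℝ) : ℂ) := by
    intro ξ
    have hs := add_mul_I_mem_slitPlane hc0 (2 * π * ξ)
    have key := integral_cpow_mul_cexp_neg_mul_Ioi (a := z + 1)
      (r := (c : ℂ) + (2 * π * ξ : ℝ) * Complex.I) (by linarith) (by simpa using hc0)
    rw [one_div, Complex.inv_cpow _ _ (Complex.slitPlane_arg_ne_pi hs), ← Complex.cpow_neg] at key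
    rw [Real.fourier_eq', mul_comm (Complex.Gamma _)]
    push_cast at key ⊢
    rw [← key, ← integral_indicator measurableSet_Ioi]
    congr 1
    ext u
    by_cases hu : u ∈ Set.Ioi (0 : ℝ)
    · simp only [hf, hu, Set.indicator_of_mem, smul_eq_mul]
      rw [mul_left_comm, ← Complex.exp_add]
      congr 2
      simp
      ring
    · simp [hf, hu]
  have hFi : Integrable (𝓕 f) := by
    have h1 : Integrable fun y : ℝ => ((c : ℂ) + y * Complex.I) ^ ((-(z + 1) : ℝ) : ℂ) := by
      refine (integrable_norm_add_mul_I_rpow_neg hc (p := z + 1) (by linarith)).mono' ?_ ?_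
      · refine (Continuous.cpow (by fun_prop) (by fun_prop) fun y =>
          add_mul_I_mem_slitPlane hc0 y).aestronglyMeasurable
      · refine ae_of_all _ fun y => ?_
        rw [Complex.norm_cpow_real]
    rw [show 𝓕 f = _ from funext hF]
    exact (h1.comp_mul_left' (by positivity : 2 * π ≠ 0)).const_mul _
  have hinv := hfi.fourierInv_fourier_eq hFi (v := 1) (by
    have : (fun u : ℝ => (u : ℂ) ^ ((z + 1 : ℂ) - 1) * Complex.exp (-(c * u))) =ᶠ[𝓝 1] f := by
      filter_upwards [Ioi_mem_nhds (zero_lt_one' ℝ)] with u hu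
      simp only [hf, hu, Set.indicator_of_mem]
    refine ContinuousAt.congr ?_ this
    refine ContinuousAt.mul ?_ (by fun_prop)
    exact ContinuousAt.cpow (by fun_prop) (by fun_prop) (by simp))
  have hG : Complex.Gamma (z + 1) = (Real.Gamma (z + 1) : ℂ) := by
    rw [← Complex.Gamma_ofReal]; push_cast; rfl
  have hG0 : (Real.Gamma (z + 1) : ℂ) ≠ 0 :=
    Complex.ofReal_ne_zero.mpr (Real.Gamma_pos_of_pos (by linarith)).ne'
  have hint : 𝓕⁻ (𝓕 f) 1 = Complex.exp (-c) * Real.Gamma (z + 1) *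
      ∫ ξ : ℝ, (fun y : ℝ => Complex.exp ((c : ℂ) + y * Complex.I) *
      ((c : ℂ) + y * Complex.I) ^ ((-(z + 1) : ℝ) : ℂ)) (2 * π * ξ) := by
    rw [Real.fourierInv_eq', ← integral_const_mul]
    congr 1
    ext ξ
    beta_reduce
    rw [hF, hG, Complex.exp_add, smul_eq_mul, Complex.exp_neg]
    have := Complex.exp_ne_zero c
    rw [show (2 * π * inner ℝ ξ 1 : ℝ) = 2 * π * ξ by simp]
    field_simp
  rw [hint, Measure.integral_comp_mul_left (fun y : ℝ => Complex.exp ((c : ℂ) + y * Complex.I) *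
      ((c : ℂ) + y * Complex.I) ^ ((-(z + 1) : ℝ) : ℂ)) (2 * π)] at hinv
  have hf1 : f 1 = Complex.exp (-c) := by simp [hf]
  rw [hf1, mul_assoc, mul_eq_left₀ (Complex.exp_ne_zero _), abs_of_pos (by positivity)] at hinv
  push_cast
  rw [eq_div_iff hG0]
  have hpi : (π : ℂ) ≠ 0 := by exact_mod_cast Real.pi_ne_zero
  rw [Complex.real_smul] at hinv
  push_cast at hinv ⊢
  field_simp at hinv
  linear_combination hinv

/-- Integrals over vertical lines of a decaying holomorphic function do not depend on the line. -/
lemma integral_vertical_line_eq {f : ℂ → ℂ} {a b C p : ℝ} (ha : 0 < a) (hab : a ≤ b)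
    (hC : 0 ≤ C) (hp : 0 < p) (hf : DifferentiableOn ℂ f {s | 0 < s.re})
    (hbd : ∀ s : ℂ, a ≤ s.re → s.re ≤ b → ‖f s‖ ≤ C * ‖s‖ ^ (-p))
    (hfa : Integrable fun y : ℝ => f (a + y * Complex.I))
    (hfb : Integrable fun y : ℝ => f (b + y * Complex.I)) :
    ∫ y : ℝ, f (a + y * Complex.I) = ∫ y : ℝ, f (b + y * Complex.I) := by
  have hrect : ∀ T : ℝ, (∫ x : ℝ in a..b, f (x + ((-T : ℝ) : ℂ) * Complex.I)) -
      (∫ x : ℝ in a..b, f (x + (T : ℂ) * Complex.I)) +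
      Complex.I • (∫ y : ℝ in (-T)..T, f (b + y * Complex.I)) -
      Complex.I • (∫ y : ℝ in (-T)..T, f (a + y * Complex.I)) = 0 := by
    intro T
    have h := Complex.integral_boundary_rect_eq_zero_of_differentiableOn f
      (⟨a, -T⟩ : ℂ) (⟨b, T⟩ : ℂ) (hf.mono ?_)
    · simpa only using h
    · intro s hs
      have h1 := hs.1
      simp only [Set.uIcc_of_le hab, Set.mem_preimage, Set.mem_Icc] at h1
      exact ha.trans_le h1.1
  have hside : ∀ σ : ℝ, |σ| = 1 →
      Tendsto (fun T : ℝ => ∫ x : ℝ in a..b, f (x + ((σ * T : ℝ) : ℂ) * Complex.I))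
        atTop (𝓝 0) := by
    intro σ hσ
    have hlim : Tendsto (fun T : ℝ => C * T ^ (-p) * |b - a|) atTop (𝓝 0) := by
      simpa using ((tendsto_rpow_neg_atTop hp).const_mul C).mul_const |b - a|
    refine squeeze_zero_norm' ?_ hlim
    filter_upwards [eventually_gt_atTop 0] with T hT
    refine intervalIntegral.norm_integral_le_of_norm_le_const fun x hx => ?_
    rw [Set.uIoc_of_le hab] at hx
    refine (hbd _ (by simpa using hx.1.le) (by simpa using hx.2)).trans ?_
    refine mul_le_mul_of_nonneg_left ?_ hC
    refine Real.rpow_le_rpow_of_nonpos hT ?_ (by linarith)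
    refine le_trans ?_ (Complex.abs_im_le_norm _)
    simp [abs_mul, hσ, abs_of_pos hT]
  have hb' := intervalIntegral_tendsto_integral hfb tendsto_neg_atTop_atBot tendsto_id
  have ha' := intervalIntegral_tendsto_integral hfa tendsto_neg_atTop_atBot tendsto_id
  have hm := hside (-1) (by simp)
  have hp' := hside 1 (by simp)
  have htot := ((hm.sub hp').add (hb'.const_smul Complex.I)).sub (ha'.const_smul Complex.I)
  have hzero := tendsto_nhds_unique (htot.congr fun T => by
    simpa using hrect T) tendsto_const_nhds
  rw [sub_zero, zero_add, ← smul_sub, smul_eq_zero_iff_right Complex.I_ne_zero] at hzero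
  exact (sub_eq_zero.mp hzero).symm

lemma cos_mul_pi_div_four_pos {μ : ℝ} (hμ0 : 0 < μ) (hμ2 : μ < 2) : 0 < cos (μ * π / 4) :=
  Real.cos_pos_of_mem_Ioo ⟨by nlinarith [Real.pi_pos], by nlinarith [Real.pi_pos]⟩

lemma cos_mul_le_norm_cpow_add {μ t : ℝ} (hμ0 : 0 < μ) (hμ2 : μ < 2) (ht : 0 ≤ t) {s : ℂ}
    (hs : 0 < s.re) : cos (μ * π / 4) * (‖s‖ ^ μ + t) ≤ ‖s ^ (μ : ℂ) + t‖ := by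
  have hs0 : s ≠ 0 := by rintro rfl; simp at hs
  have harg : |s.arg| < π / 2 := Complex.abs_arg_lt_pi_div_two_iff.mpr (Or.inl hs)
  set φ : ℝ := s.arg * μ / 2 with hφ
  have hcos : cos (μ * π / 4) ≤ cos φ := by
    rw [← Real.cos_abs φ]
    refine Real.cos_le_cos_of_nonneg_of_le_pi (abs_nonneg _) (by nlinarith [Real.pi_pos]) ?_
    rw [hφ, abs_div, abs_mul, abs_of_pos hμ0, abs_two]
    nlinarith
  have hre : (Complex.exp (-(φ * Complex.I)) * (s ^ (μ : ℂ) + t)).re = cos φ * (‖s‖ ^ μ + t) := by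
    have h1 : s ^ (μ : ℂ) = (‖s‖ ^ μ : ℝ) * Complex.exp ((2 * φ : ℝ) * Complex.I) := by
      rw [Complex.cpow_def_of_ne_zero hs0, Real.rpow_def_of_pos (norm_pos_iff.mpr hs0),
        Complex.ofReal_exp, ← Complex.exp_add]
      congr 1
      conv_lhs => rw [← Complex.re_add_im (Complex.log s), Complex.log_re, Complex.log_im]
      rw [hφ]
      push_cast
      ring
    rw [h1, mul_add, mul_left_comm, ← Complex.exp_add,
      show -((φ : ℂ) * Complex.I) + (2 * φ : ℝ) * Complex.I = φ * Complex.I by push_cast; ring,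
      Complex.add_re, Complex.re_ofReal_mul, mul_comm _ (t : ℂ), Complex.re_ofReal_mul,
      Complex.exp_ofReal_mul_I_re, ← neg_mul, ← Complex.ofReal_neg,
      Complex.exp_ofReal_mul_I_re, Real.cos_neg]
    ring
  calc cos (μ * π / 4) * (‖s‖ ^ μ + t) ≤ cos φ * (‖s‖ ^ μ + t) := by gcongr
    _ ≤ ‖Complex.exp (-(φ * Complex.I)) * (s ^ (μ : ℂ) + t)‖ := hre ▸ Complex.re_le_norm _
    _ = ‖s ^ (μ : ℂ) + t‖ := by
      rw [norm_mul, ← neg_mul, ← Complex.ofReal_neg, Complex.norm_exp_ofReal_mul_I, one_mul]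

lemma cpow_add_ofReal_ne_zero {μ t : ℝ} (hμ0 : 0 < μ) (hμ2 : μ < 2) (ht : 0 ≤ t) {s : ℂ}
    (hs : 0 < s.re) : s ^ (μ : ℂ) + t ≠ 0 := by
  have hs0 : s ≠ 0 := by rintro rfl; simp at hs
  have := norm_pos_iff.mpr hs0
  have := cos_mul_pi_div_four_pos hμ0 hμ2
  exact norm_pos_iff.mp (lt_of_lt_of_le (by positivity) (cos_mul_le_norm_cpow_add hμ0 hμ2 ht hs))

/-- Minus the derivative of `s ^ (μ - η) / (s ^ μ + t)`, the Laplace transform of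
`x ^ (η - 1) * mittagLeffler μ η (-t * x ^ μ)`. -/
noncomputable def mittagLefflerKernel (μ η t : ℝ) (s : ℂ) : ℂ :=
  s ^ ((-(η + 1) : ℝ) : ℂ) * (s ^ (μ : ℂ) / (s ^ (μ : ℂ) + t)) *
    (η - μ * (t / (s ^ (μ : ℂ) + t)))

lemma norm_mittagLefflerKernel_le {μ η t : ℝ} (hμ0 : 0 < μ) (hμ2 : μ < 2) (hη : 0 < η)
    (ht : 0 ≤ t) {s : ℂ} (hs : 0 < s.re) :
    ‖mittagLefflerKernel μ η t s‖ ≤ (η + μ / cos (μ * π / 4)) / cos (μ * π / 4) *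
      (‖s‖ ^ (-(η + 1)) * (‖s‖ ^ μ / (‖s‖ ^ μ + t))) := by
  have hs0 : s ≠ 0 := by rintro rfl; simp at hs
  have hn := norm_pos_iff.mpr hs0
  have hδ := cos_mul_pi_div_four_pos hμ0 hμ2
  have hρ : 0 < ‖s‖ ^ μ := by positivity
  have hB := cos_mul_le_norm_cpow_add hμ0 hμ2 ht hs
  rw [mittagLefflerKernel]
  set δ := cos (μ * π / 4)
  set ρ := ‖s‖ ^ μ with hρ'
  have hpos : 0 < δ * (ρ + t) := by positivity
  have h1 : ‖s ^ (μ : ℂ) / (s ^ (μ : ℂ) + t)‖ ≤ ρ / (δ * (ρ + t)) := by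
    rw [norm_div, Complex.norm_cpow_real]
    gcongr
  have h2 : ‖(t : ℂ) / (s ^ (μ : ℂ) + t)‖ ≤ 1 / δ := by
    rw [norm_div, Complex.norm_of_nonneg ht, div_le_div_iff₀ (hpos.trans_le hB) hδ]
    nlinarith
  have h3 : ‖(η : ℂ) - μ * (t / (s ^ (μ : ℂ) + t))‖ ≤ η + μ / δ := by
    refine (norm_sub_le _ _).trans ?_
    rw [norm_mul, Complex.norm_of_nonneg hη.le, Complex.norm_of_nonneg hμ0.le, div_eq_mul_one_div μ]
    gcongr
  rw [norm_mul, norm_mul, Complex.norm_cpow_real]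
  calc _ ≤ ‖s‖ ^ (-(η + 1)) * (ρ / (δ * (ρ + t))) * (η + μ / δ) := by gcongr
    _ = _ := by field_simp

lemma norm_mittagLefflerKernel_le_rpow {μ η t : ℝ} (hμ0 : 0 < μ) (hμ2 : μ < 2) (hη : 0 < η)
    (ht : 0 ≤ t) {s : ℂ} (hs : 0 < s.re) :
    ‖mittagLefflerKernel μ η t s‖ ≤ (η + μ / cos (μ * π / 4)) / cos (μ * π / 4) *
      ‖s‖ ^ (-(η + 1)) := by
  have hs0 : s ≠ 0 := by rintro rfl; simp at hs
  have hn := norm_pos_iff.mpr hs0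
  have hδ := cos_mul_pi_div_four_pos hμ0 hμ2
  have hρ : 0 < ‖s‖ ^ μ := by positivity
  refine (norm_mittagLefflerKernel_le hμ0 hμ2 hη ht hs).trans ?_
  gcongr
  exact mul_le_of_le_one_right (by positivity) ((div_le_one (by positivity)).mpr (by linarith))

lemma mul_norm_mittagLefflerKernel_le_rpow {μ η t : ℝ} (hμ0 : 0 < μ) (hμ2 : μ < 2) (hη : 0 < η)
    (ht : 0 ≤ t) {s : ℂ} (hs : 0 < s.re) :
    t * ‖mittagLefflerKernel μ η t s‖ ≤ (η + μ / cos (μ * π / 4)) / cos (μ * π / 4) *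
      ‖s‖ ^ (-(η - μ + 1)) := by
  have hs0 : s ≠ 0 := by rintro rfl; simp at hs
  have hn := norm_pos_iff.mpr hs0
  have hδ := cos_mul_pi_div_four_pos hμ0 hμ2
  have hρ : 0 < ‖s‖ ^ μ := by positivity
  calc _ ≤ t * ((η + μ / cos (μ * π / 4)) / cos (μ * π / 4) *
      (‖s‖ ^ (-(η + 1)) * (‖s‖ ^ μ / (‖s‖ ^ μ + t)))) := by
        gcongr
        exact norm_mittagLefflerKernel_le hμ0 hμ2 hη ht hs
    _ = (η + μ / cos (μ * π / 4)) / cos (μ * π / 4) *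
      (‖s‖ ^ (-(η + 1)) * ‖s‖ ^ μ) * (t / (‖s‖ ^ μ + t)) := by ring
    _ ≤ (η + μ / cos (μ * π / 4)) / cos (μ * π / 4) * (‖s‖ ^ (-(η + 1)) * ‖s‖ ^ μ) :=
        mul_le_of_le_one_right (by positivity) ((div_le_one (by positivity)).mpr (by linarith))
    _ = _ := by
        rw [← Real.rpow_add hn]
        congr 2
        ring

lemma differentiableOn_mittagLefflerKernel {μ η t : ℝ} (hμ0 : 0 < μ) (hμ2 : μ < 2)
    (ht : 0 ≤ t) : DifferentiableOn ℂ (mittagLefflerKernel μ η t) {s | 0 < s.re} := by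
  intro s hs
  have hd : ∀ p : ℂ, DifferentiableAt ℂ (fun w : ℂ => w ^ p) s := fun p =>
    DifferentiableAt.cpow_const differentiableAt_id (Or.inl hs)
  have h0 := cpow_add_ofReal_ne_zero hμ0 hμ2 ht hs
  unfold mittagLefflerKernel
  refine DifferentiableAt.differentiableWithinAt ?_
  have hB := (hd μ).add_const (t : ℂ)
  exact ((hd _).mul ((hd μ).div hB h0)).mul
    ((((differentiableAt_const _).div hB h0).const_mul _).const_sub _)

lemma continuous_mittagLefflerKernel_vertical {μ η t c : ℝ} (hμ0 : 0 < μ) (hμ2 : μ < 2)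
    (ht : 0 ≤ t) (hc : 0 < c) :
    Continuous fun y : ℝ => mittagLefflerKernel μ η t (c + y * Complex.I) := by
  refine (differentiableOn_mittagLefflerKernel hμ0 hμ2 ht).continuousOn.comp_continuous
    (by fun_prop) fun y => ?_
  simpa using hc

lemma norm_exp_add_mul_I (c y : ℝ) : ‖Complex.exp ((c : ℂ) + y * Complex.I)‖ = rexp c := by
  simp [Complex.norm_exp]

lemma integrable_exp_mul_mittagLefflerKernel {μ η t c : ℝ} (hμ0 : 0 < μ) (hμ2 : μ < 2)
    (hη : 0 < η) (ht : 0 ≤ t) (hc : 1 ≤ c) :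
    Integrable fun y : ℝ => Complex.exp (c + y * Complex.I) *
      mittagLefflerKernel μ η t (c + y * Complex.I) := by
  refine ((integrable_norm_add_mul_I_rpow_neg hc (p := η + 1) (by linarith)).const_mul
    (rexp c * ((η + μ / cos (μ * π / 4)) / cos (μ * π / 4)))).mono' ?_ ?_
  · have := continuous_mittagLefflerKernel_vertical (η := η) hμ0 hμ2 ht (zero_lt_one.trans_le hc)
    exact Continuous.aestronglyMeasurable (by fun_prop)
  · refine ae_of_all _ fun y => ?_
    rw [norm_mul, norm_exp_add_mul_I, mul_assoc]
    gcongr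
    exact norm_mittagLefflerKernel_le_rpow hμ0 hμ2 hη ht (by simp; linarith)

lemma integral_exp_mul_mittagLefflerKernel_eq {μ η t c : ℝ} (hμ0 : 0 < μ) (hμ2 : μ < 2)
    (hη : 0 < η) (ht : 0 ≤ t) (hc : 1 ≤ c) :
    ∫ y : ℝ, Complex.exp ((1 : ℝ) + y * Complex.I) *
        mittagLefflerKernel μ η t ((1 : ℝ) + y * Complex.I) =
      ∫ y : ℝ, Complex.exp (c + y * Complex.I) *
        mittagLefflerKernel μ η t (c + y * Complex.I) := by
  have hδ := cos_mul_pi_div_four_pos hμ0 hμ2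
  refine integral_vertical_line_eq (f := fun s => Complex.exp s * mittagLefflerKernel μ η t s)
    (C := rexp c * ((η + μ / cos (μ * π / 4)) / cos (μ * π / 4))) (p := η + 1)
    one_pos hc (by positivity) (by linarith) ?_ ?_
    (integrable_exp_mul_mittagLefflerKernel hμ0 hμ2 hη ht le_rfl)
    (integrable_exp_mul_mittagLefflerKernel hμ0 hμ2 hη ht hc)
  · exact Complex.differentiable_exp.differentiableOn.mul
      (differentiableOn_mittagLefflerKernel hμ0 hμ2 ht)
  · intro s hs1 hsc
    rw [norm_mul, Complex.norm_exp, mul_assoc]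
    gcongr
    exact norm_mittagLefflerKernel_le_rpow hμ0 hμ2 hη ht (by linarith)

lemma hasSum_mittagLefflerKernel {μ η t : ℝ} (hμ0 : 0 < μ) (hμ2 : μ < 2) (ht : 0 ≤ t) {s : ℂ}
    (hs : 0 < s.re) (hq : t * ‖s‖ ^ (-μ) < 1) :
    HasSum (fun n : ℕ => (-(t : ℂ)) ^ n * (μ * n + η) * s ^ ((-(μ * n + η + 1) : ℝ) : ℂ))
      (mittagLefflerKernel μ η t s) := by
  have hs0 : s ≠ 0 := by rintro rfl; simp at hs
  have hA : s ^ (μ : ℂ) ≠ 0 := by simp [Complex.cpow_eq_zero_iff, hs0]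
  have hB := cpow_add_ofReal_ne_zero hμ0 hμ2 ht hs
  set q : ℂ := -t * s ^ ((-μ : ℝ) : ℂ) with hqdef
  have hqn : ‖q‖ < 1 := by
    rwa [hqdef, norm_mul, norm_neg, Complex.norm_of_nonneg ht, Complex.norm_cpow_real]
  have hq' : q = -t / s ^ (μ : ℂ) := by
    rw [hqdef, Complex.ofReal_neg, Complex.cpow_neg, div_eq_mul_inv]
  have h1q : 1 - q = (s ^ (μ : ℂ) + t) / s ^ (μ : ℂ) := by
    rw [hq']; field_simp; ring
  have h := (((hasSum_coe_mul_geometric_of_norm_lt_one hqn).mul_left (μ : ℂ)).add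
    ((hasSum_geometric_of_norm_lt_one hqn).mul_left (η : ℂ))).mul_left
    (s ^ ((-(η + 1) : ℝ) : ℂ))
  convert! h using 1
  · ext n
    have : s ^ ((-(μ * n + η + 1) : ℝ) : ℂ) =
        s ^ ((-(η + 1) : ℝ) : ℂ) * (s ^ ((-μ : ℝ) : ℂ)) ^ n := by
      rw [← Complex.cpow_mul_nat, ← Complex.cpow_add _ _ hs0]
      congr 1
      push_cast
      ring
    rw [this, hqdef, mul_pow]
    ring
  · rw [mittagLefflerKernel, h1q, hq']
    field_simp
    ring

lemma exists_one_le_mul_rpow_neg_lt_one {μ : ℝ} (hμ0 : 0 < μ) (t : ℝ) :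
    ∃ c : ℝ, 1 ≤ c ∧ t * c ^ (-μ) < 1 := by
  have h : Tendsto (fun c : ℝ => t * c ^ (-μ)) atTop (𝓝 0) := by
    simpa using (tendsto_rpow_neg_atTop hμ0).const_mul t
  exact ((eventually_ge_atTop 1).and (h.eventually_lt_const one_pos)).exists

lemma mittagLeffler_neg_eq_integral {μ η t : ℝ} (hμ0 : 0 < μ) (hμ2 : μ < 2)
    (hη : 0 < η) (ht : 0 ≤ t) :
    (mittagLeffler μ η (-t) : ℂ) = (2 * π : ℂ)⁻¹ *
      ∫ y : ℝ, Complex.exp ((1 : ℝ) + y * Complex.I) *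
        mittagLefflerKernel μ η t ((1 : ℝ) + y * Complex.I) := by
  obtain ⟨c, hc, hr1⟩ := exists_one_le_mul_rpow_neg_lt_one hμ0 t
  have hc0 : 0 < c := by linarith
  rw [integral_exp_mul_mittagLefflerKernel_eq hμ0 hμ2 hη ht hc]
  set r := t * c ^ (-μ) with hr
  have hr0 : 0 ≤ r := by positivity
  have hnorm : ∀ y : ℝ, t * ‖(c : ℂ) + y * Complex.I‖ ^ (-μ) ≤ r := by
    intro y
    refine mul_le_mul_of_nonneg_left ?_ ht
    refine Real.rpow_le_rpow_of_nonpos hc0 ?_ (by linarith)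
    simpa using Complex.re_le_norm ((c : ℂ) + y * Complex.I)
  have hsum : Summable fun n : ℕ => (μ * n + η) * r ^ n := by
    have hrn : ‖r‖ < 1 := by rwa [Real.norm_of_nonneg hr0]
    refine (((hasSum_coe_mul_geometric_of_norm_lt_one hrn).summable.mul_left μ).add
      ((hasSum_geometric_of_norm_lt_one hrn).summable.mul_left η)).congr fun n => ?_
    ring
  have key := hasSum_integral_of_dominated_convergence (μ := volume)
    (F := fun (n : ℕ) (y : ℝ) => Complex.exp (c + y * Complex.I) * ((-(t : ℂ)) ^ n * (μ * n + η) *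
      ((c : ℂ) + y * Complex.I) ^ ((-(μ * n + η + 1) : ℝ) : ℂ)))
    (f := fun y : ℝ => Complex.exp (c + y * Complex.I) *
      mittagLefflerKernel μ η t (c + y * Complex.I))
    (fun n y => rexp c * ‖(c : ℂ) + y * Complex.I‖ ^ (-(η + 1)) * ((μ * n + η) * r ^ n))
    ?_ ?_ ?_ ?_ ?_
  · have hterm : ∀ n : ℕ, ∫ y : ℝ, Complex.exp (c + y * Complex.I) * ((-(t : ℂ)) ^ n *
        (μ * n + η) * ((c : ℂ) + y * Complex.I) ^ ((-(μ * n + η + 1) : ℝ) : ℂ)) =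
        2 * π * (((-t) ^ n / Real.Gamma (μ * n + η) : ℝ) : ℂ) := by
      intro n
      have hz : 0 < μ * n + η := by positivity
      have hz' : ((μ * n + η : ℝ) : ℂ) ≠ 0 := Complex.ofReal_ne_zero.mpr hz.ne'
      have hG : (Real.Gamma (μ * n + η) : ℂ) ≠ 0 :=
        Complex.ofReal_ne_zero.mpr (Real.Gamma_pos_of_pos hz).ne'
      simp_rw [mul_left_comm (Complex.exp _)]
      rw [integral_const_mul, integral_exp_mul_cpow_neg hc hz, Real.Gamma_add_one hz.ne']
      push_cast at hz' ⊢
      field_simp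
    simp_rw [hterm] at key
    have hpi : (2 * π : ℂ) ≠ 0 := by exact_mod_cast (by positivity : 2 * π ≠ 0)
    rw [← key.tsum_eq, tsum_mul_left, inv_mul_cancel_left₀ hpi, mittagLeffler,
      Complex.ofReal_tsum]
  · intro n
    refine Continuous.aestronglyMeasurable ?_
    have : Continuous fun y : ℝ => ((c : ℂ) + y * Complex.I) ^ ((-(μ * n + η + 1) : ℝ) : ℂ) :=
      Continuous.cpow (by fun_prop) (by fun_prop) fun y => add_mul_I_mem_slitPlane hc0 y
    fun_prop
  · refine fun n => ae_of_all _ fun y => ?_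
    have hn : 0 < ‖(c : ℂ) + y * Complex.I‖ := norm_pos_iff.mpr (add_mul_I_ne_zero hc0 y)
    have hz : 0 < μ * n + η := by positivity
    have hz' : ‖(μ * n + η : ℂ)‖ = μ * n + η := by
      exact_mod_cast Complex.norm_of_nonneg hz.le
    have he : ‖(c : ℂ) + y * Complex.I‖ ^ (-(μ * n + η + 1)) =
        ‖(c : ℂ) + y * Complex.I‖ ^ (-(η + 1)) * (‖(c : ℂ) + y * Complex.I‖ ^ (-μ)) ^ n := by
      rw [← Real.rpow_mul_natCast hn.le, ← Real.rpow_add hn]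
      congr 1
      ring
    rw [norm_mul, norm_mul, norm_mul, norm_exp_add_mul_I, norm_pow, norm_neg,
      Complex.norm_of_nonneg ht, hz', Complex.norm_cpow_real, he]
    calc _ = rexp c * ‖(c : ℂ) + y * Complex.I‖ ^ (-(η + 1)) *
          ((μ * n + η) * (t * ‖(c : ℂ) + y * Complex.I‖ ^ (-μ)) ^ n) := by rw [mul_pow]; ring
      _ ≤ _ := by gcongr; exact hnorm y
  · exact ae_of_all _ fun y => hsum.mul_left _
  · simp_rw [tsum_mul_left]
    exact ((integrable_norm_add_mul_I_rpow_neg hc (by linarith)).const_mul _).mul_const _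
  · exact ae_of_all _ fun y => (hasSum_mittagLefflerKernel hμ0 hμ2 ht (by simpa using hc0)
      ((hnorm y).trans_lt hr1)).mul_left _

lemma tendsto_ofReal_div_const_add_ofReal (A : ℂ) :
    Tendsto (fun t : ℝ => (t : ℂ) / (A + t)) atTop (𝓝 1) := by
  have h : Tendsto (fun t : ℝ => A / (t : ℂ) + 1) atTop (𝓝 (0 + 1)) := by
    refine Tendsto.add_const 1 ?_
    rw [tendsto_zero_iff_norm_tendsto_zero]
    simpa [norm_div] using tendsto_const_nhds.div_atTop tendsto_abs_atTop_atTop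
  rw [zero_add] at h
  have h' := h.inv₀ one_ne_zero
  rw [inv_one] at h'
  refine h'.congr' ?_
  filter_upwards [eventually_gt_atTop 0] with t ht
  have : (t : ℂ) ≠ 0 := Complex.ofReal_ne_zero.mpr ht.ne'
  rw [div_add_one this, inv_div]

lemma tendsto_mul_mittagLefflerKernel {μ η : ℝ} {s : ℂ} (hs : s ≠ 0) :
    Tendsto (fun t : ℝ => t * mittagLefflerKernel μ η t s) atTop
      (𝓝 ((η - μ) * s ^ ((-(η - μ + 1) : ℝ) : ℂ))) := by
  have h := tendsto_ofReal_div_const_add_ofReal (s ^ (μ : ℂ))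
  have h2 := (h.const_mul (s ^ ((-(η + 1) : ℝ) : ℂ) * s ^ (μ : ℂ))).mul
    ((h.const_mul (μ : ℂ)).const_sub (η : ℂ))
  convert! h2 using 1
  · ext t
    rw [mittagLefflerKernel]
    ring
  · rw [← Complex.cpow_add _ _ hs, mul_one, mul_one, mul_comm]
    congr 3
    push_cast
    ring

/-- Leading-order asymptotics of the Mittag-Leffler function on the negative real axis. -/
lemma tendsto_mul_mittagLeffler_neg {μ η : ℝ} (hμ0 : 0 < μ) (hμ2 : μ < 2) (hμη : μ < η) :
    Tendsto (fun t : ℝ => t * mittagLeffler μ η (-t)) atTop (𝓝 (1 / Real.Gamma (η - μ))) := by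
  have hη : 0 < η := hμ0.trans hμη
  have hz : 0 < η - μ := sub_pos.mpr hμη
  have key : Tendsto (fun t : ℝ => ∫ y : ℝ, Complex.exp ((1 : ℝ) + y * Complex.I) *
      (t * mittagLefflerKernel μ η t ((1 : ℝ) + y * Complex.I))) atTop
      (𝓝 (∫ y : ℝ, Complex.exp ((1 : ℝ) + y * Complex.I) *
        ((η - μ) * ((1 : ℝ) + y * Complex.I) ^ ((-(η - μ + 1) : ℝ) : ℂ)))) := by
    refine tendsto_integral_filter_of_dominated_convergence
      (fun y => rexp 1 * ((η + μ / cos (μ * π / 4)) / cos (μ * π / 4)) *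
        ‖((1 : ℝ) : ℂ) + y * Complex.I‖ ^ (-(η - μ + 1))) ?_ ?_ ?_ ?_
    · filter_upwards [eventually_ge_atTop 0] with t ht
      have := continuous_mittagLefflerKernel_vertical (η := η) hμ0 hμ2 ht one_pos
      exact Continuous.aestronglyMeasurable (by fun_prop)
    · filter_upwards [eventually_ge_atTop 0] with t ht
      refine ae_of_all _ fun y => ?_
      rw [norm_mul, norm_exp_add_mul_I, norm_mul, Complex.norm_of_nonneg ht, mul_assoc (rexp 1)]
      exact mul_le_mul_of_nonneg_left
        (mul_norm_mittagLefflerKernel_le_rpow hμ0 hμ2 hη ht (by simp)) (Real.exp_pos 1).le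
    · exact (integrable_norm_add_mul_I_rpow_neg le_rfl (by linarith)).const_mul _
    · exact ae_of_all _ fun y =>
        (tendsto_mul_mittagLefflerKernel (add_mul_I_ne_zero one_pos y)).const_mul _
  simp_rw [mul_left_comm (Complex.exp _), integral_const_mul] at key
  rw [integral_exp_mul_cpow_neg le_rfl hz, Real.Gamma_add_one hz.ne'] at key
  rw [← Filter.tendsto_ofReal_iff]
  refine Tendsto.congr' ?_ ((key.const_mul (2 * π : ℂ)⁻¹).mono_right (le_of_eq ?_))
  · filter_upwards [eventually_ge_atTop 0] with t ht
    rw [Complex.ofReal_mul, mittagLeffler_neg_eq_integral hμ0 hμ2 hη ht]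
    ring
  · congr 1
    have hpi : (π : ℂ) ≠ 0 := Complex.ofReal_ne_zero.mpr Real.pi_ne_zero
    have hz' : ((η - μ : ℝ) : ℂ) ≠ 0 := Complex.ofReal_ne_zero.mpr hz.ne'
    push_cast at hz' ⊢
    field_simp

lemma tendsto_mittagLeffler_neg {μ η : ℝ} (hμ0 : 0 < μ) (hμ2 : μ < 2) (hη : 0 < η) :
    Tendsto (fun t : ℝ => mittagLeffler μ η (-t)) atTop (𝓝 0) := by
  have key : Tendsto (fun t : ℝ => ∫ y : ℝ, Complex.exp ((1 : ℝ) + y * Complex.I) *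
      mittagLefflerKernel μ η t ((1 : ℝ) + y * Complex.I)) atTop (𝓝 (∫ _ : ℝ, (0 : ℂ))) := by
    refine tendsto_integral_filter_of_dominated_convergence
      (fun y => rexp 1 * ((η + μ / cos (μ * π / 4)) / cos (μ * π / 4)) *
        ‖((1 : ℝ) : ℂ) + y * Complex.I‖ ^ (-(η + 1))) ?_ ?_ ?_ ?_
    · filter_upwards [eventually_ge_atTop 0] with t ht
      have := continuous_mittagLefflerKernel_vertical (η := η) hμ0 hμ2 ht one_pos
      exact Continuous.aestronglyMeasurable (by fun_prop)
    · filter_upwards [eventually_ge_atTop 0] with t ht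
      refine ae_of_all _ fun y => ?_
      rw [norm_mul, norm_exp_add_mul_I, mul_assoc (rexp 1)]
      gcongr
      exact norm_mittagLefflerKernel_le_rpow hμ0 hμ2 hη ht (by simp)
    · exact (integrable_norm_add_mul_I_rpow_neg le_rfl (by linarith)).const_mul _
    · refine ae_of_all _ fun y => ?_
      have h := (tendsto_mul_mittagLefflerKernel (μ := μ) (η := η)
        (add_mul_I_ne_zero one_pos y)).mul (Filter.tendsto_ofReal_iff.mpr tendsto_inv_atTop_zero)
      rw [Complex.ofReal_zero, mul_zero] at h
      rw [← mul_zero (Complex.exp ((1 : ℝ) + y * Complex.I))]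
      refine (h.congr' ?_).const_mul _
      filter_upwards [eventually_gt_atTop 0] with t ht
      have : (t : ℂ) ≠ 0 := Complex.ofReal_ne_zero.mpr ht.ne'
      push_cast
      field_simp
  rw [← Filter.tendsto_ofReal_iff]
  refine Tendsto.congr' ?_ ((key.const_mul (2 * π : ℂ)⁻¹).mono_right (le_of_eq (by simp)))
  filter_upwards [eventually_ge_atTop 0] with t ht
  rw [mittagLeffler_neg_eq_integral hμ0 hμ2 hη ht]

theorem delta_limit (α β a b : ℝ) (hα0 : 0 < α) (hα1 : α < 1) (hβ1 : 1 < β) (hβ2 : β < 2)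
    (ha : 0 < a) (hb : 0 < b) (lam : ℕ → ℝ) (hlam : ∀ k, 0 < lam k)
    (hlim : Tendsto lam atTop atTop) :
    Tendsto (fun k : ℕ =>
        mittagLeffler α 1 (-(lam k * b ^ α)) -
          (mittagLeffler β 1 (-(lam k * a ^ β)) +
            a * lam k * mittagLeffler β 2 (-(lam k * a ^ β))))
      atTop (nhds (-(1 / (a ^ (β - 1) * Real.Gamma (2 - β))))) := by
  have hβ0 : 0 < β := by linarith
  have hbα : Tendsto (fun k => lam k * b ^ α) atTop atTop :=
    hlim.atTop_mul_const (by positivity)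
  have haβ : Tendsto (fun k => lam k * a ^ β) atTop atTop :=
    hlim.atTop_mul_const (by positivity)
  have h1 := (tendsto_mittagLeffler_neg hα0 (by linarith) one_pos).comp hbα
  have h2 := (tendsto_mittagLeffler_neg hβ0 hβ2 one_pos).comp haβ
  have h3 := ((tendsto_mul_mittagLeffler_neg hβ0 hβ2 hβ2).comp haβ).div_const (a ^ (β - 1))
  have hpow : a ^ β = a ^ (β - 1) * a := by rw [← Real.rpow_add_one ha.ne', sub_add_cancel]
  refine ((h1.sub (h2.add h3)).congr fun k => ?_).mono_right (le_of_eq ?_)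
  · have : a ^ (β - 1) ≠ 0 := by positivity
    have h : lam k * a ^ β / a ^ (β - 1) = a * lam k := by
      rw [hpow]; field_simp
    simp only [Function.comp_apply]
    rw [← h]
    ring
  · congr 1
    rw [div_div, mul_comm]
    ring
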